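/- Let g : ℝ → [0,∞) be measurable, let A be an invertible real n×n matrix, let Λ be a real symmetric n×n matrix, let w ∈ ℝⁿ, and let k ∈ ℝ. Set Σ = A Aᵗ, v = A⁻¹ w, and D = Aᵗ Λ A. Then the tail integral transforms as ∫_{{x ∈ ℝⁿ : xᵗ Λ x ≥ k}} g((x − w)ᵗ Σ⁻¹ (x − w)) / √(det Σ) dx = ∫_{{z ∈ ℝⁿ : (z + v)ᵗ D (z + v) ≥ k}} g(‖z‖²) dz. -/

import Mathlib

open MeasureTheory Matrix
open scoped RealInnerProductSpace NNReal ENNReal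

section

variable {n : ℕ}

lemma inner_toEuclideanLin_transpose (M : Matrix (Fin n) (Fin n) ℝ)
    (x y : EuclideanSpace ℝ (Fin n)) :
    ⟪x, Matrix.toEuclideanLin Mᵀ y⟫ = ⟪Matrix.toEuclideanLin M x, y⟫ := by
  rw [← Matrix.conjTranspose_eq_transpose_of_trivial,
    Matrix.toEuclideanLin_conjTranspose_eq_adjoint, LinearMap.adjoint_inner_right]

lemma toEuclideanLin_mul_inv_apply {A : Matrix (Fin n) (Fin n) ℝ} (hA : IsUnit A.det)
    (x : EuclideanSpace ℝ (Fin n)) :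
    Matrix.toEuclideanLin A (Matrix.toEuclideanLin A⁻¹ x) = x := by
  rw [← LinearMap.comp_apply, ← Matrix.toLpLin_mul_same, Matrix.mul_nonsing_inv _ hA,
    Matrix.toLpLin_one, LinearMap.id_apply]

lemma toEuclideanLin_inv_mul_apply {A : Matrix (Fin n) (Fin n) ℝ} (hA : IsUnit A.det)
    (x : EuclideanSpace ℝ (Fin n)) :
    Matrix.toEuclideanLin A⁻¹ (Matrix.toEuclideanLin A x) = x := by
  rw [← LinearMap.comp_apply, ← Matrix.toLpLin_mul_same, Matrix.nonsing_inv_mul _ hA,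
    Matrix.toLpLin_one, LinearMap.id_apply]

lemma inner_toEuclideanLin_transpose_mul_mul (A M : Matrix (Fin n) (Fin n) ℝ)
    (x : EuclideanSpace ℝ (Fin n)) :
    ⟪x, Matrix.toEuclideanLin (Aᵀ * M * A) x⟫ =
      ⟪Matrix.toEuclideanLin A x, Matrix.toEuclideanLin M (Matrix.toEuclideanLin A x)⟫ := by
  rw [Matrix.toLpLin_mul_same, Matrix.toLpLin_mul_same,
    LinearMap.comp_apply,
    LinearMap.comp_apply, inner_toEuclideanLin_transpose]

lemma inner_toEuclideanLin_mul_transpose_inv {A : Matrix (Fin n) (Fin n) ℝ} (hA : IsUnit A.det)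
    (z : EuclideanSpace ℝ (Fin n)) :
    ⟪Matrix.toEuclideanLin A z,
      Matrix.toEuclideanLin (A * Aᵀ)⁻¹ (Matrix.toEuclideanLin A z)⟫ = ‖z‖ ^ 2 := by
  rw [Matrix.mul_inv_rev, ← Matrix.transpose_nonsing_inv, Matrix.toLpLin_mul_same,
    LinearMap.comp_apply, inner_toEuclideanLin_transpose, toEuclideanLin_inv_mul_apply hA,
    real_inner_self_eq_norm_sq]

end

/-- with Σ = AAᵗ (A invertible), Λ symmetric, v = A⁻¹w and D = AᵗΛA, the
tail integral of the elliptic density over {xᵗΛx ≥ k} transforms into the tail integral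
of the spherical density over {(z+v)ᵗD(z+v) ≥ k}.  Quadratic forms are expressed via
the real inner product: xᵗ M x = ⟪x, M x⟫. -/
theorem elliptic_tail_integral_transform
    (n : ℕ) (g : ℝ → ℝ≥0) (hg : Measurable g)
    (A Λ : Matrix (Fin n) (Fin n) ℝ) (hA : IsUnit A.det) (hΛ : Λ.IsSymm)
    (w : EuclideanSpace ℝ (Fin n)) (k : ℝ) :
    (∫⁻ x in {x : EuclideanSpace ℝ (Fin n) | k ≤ ⟪x, Matrix.toEuclideanLin Λ x⟫},
        (g ⟪x - w, Matrix.toEuclideanLin (A * Aᵀ)⁻¹ (x - w)⟫ : ℝ≥0∞)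
          / ENNReal.ofReal (Real.sqrt (A * Aᵀ).det))
      = ∫⁻ z in {z : EuclideanSpace ℝ (Fin n) |
            k ≤ ⟪z + Matrix.toEuclideanLin A⁻¹ w,
                  Matrix.toEuclideanLin (Aᵀ * Λ * A)
                    (z + Matrix.toEuclideanLin A⁻¹ w)⟫},
          (g (‖z‖ ^ 2) : ℝ≥0∞) := by
  set L := Matrix.toEuclideanLin A with hL
  set v := Matrix.toEuclideanLin A⁻¹ w
  have hLv : L v = w := toEuclideanLin_mul_inv_apply hA w
  set S : Set (EuclideanSpace ℝ (Fin n)) :=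
    {z | k ≤ ⟪z + v, Matrix.toEuclideanLin (Aᵀ * Λ * A) (z + v)⟫} with hS
  have hSm : MeasurableSet S := by
    have hc : Continuous (Matrix.toEuclideanLin (Aᵀ * Λ * A)) :=
      LinearMap.continuous_of_finiteDimensional _
    exact (isClosed_le continuous_const (by fun_prop)).measurableSet
  have himage : {x : EuclideanSpace ℝ (Fin n) | k ≤ ⟪x, Matrix.toEuclideanLin Λ x⟫} =
      (fun z => L z + w) '' S := by
    ext x
    simp only [hS, Set.mem_ofPred_eq, Set.mem_image, inner_toEuclideanLin_transpose_mul_mul]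
    constructor
    · intro hx
      refine ⟨Matrix.toEuclideanLin A⁻¹ x - v, ?_, ?_⟩
      · rwa [sub_add_cancel, toEuclideanLin_mul_inv_apply hA]
      · rw [map_sub, hLv, hL, toEuclideanLin_mul_inv_apply hA, sub_add_cancel]
    · rintro ⟨z, hz, rfl⟩
      rwa [← hL, map_add, hLv] at hz
  have hderiv : ∀ z ∈ S, HasFDerivWithinAt (fun z => L z + w) L.toContinuousLinearMap S z :=
    fun z _ => (L.toContinuousLinearMap.hasFDerivAt.add_const w).hasFDerivWithinAt
  have hinj : Set.InjOn (fun z => L z + w) S := by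
    intro x _ y _ hxy
    have h := congrArg (Matrix.toEuclideanLin A⁻¹) (add_right_cancel hxy)
    rwa [hL, toEuclideanLin_inv_mul_apply hA, toEuclideanLin_inv_mul_apply hA] at h
  have hdet : L.toContinuousLinearMap.det = A.det := LinearMap.det_toLpLin 2 A
  have hsqrt : Real.sqrt (A * Aᵀ).det = |A.det| := by
    rw [Matrix.det_mul, Matrix.det_transpose, Real.sqrt_mul_self_eq_abs]
  rw [himage, lintegral_image_eq_lintegral_abs_det_fderiv_mul volume hSm hderiv hinj]
  refine lintegral_congr fun z => ?_
  rw [add_sub_cancel_right, hL, inner_toEuclideanLin_mul_transpose_inv hA, ← hL, hdet, hsqrt]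
  exact ENNReal.mul_div_cancel
    (ENNReal.ofReal_pos.2 (abs_pos.2 hA.ne_zero)).ne' ENNReal.ofReal_ne_top
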